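/- Let S_A and S_B be two distinct stars in a common star decomposition of a cyclic polygon P that has a minimal edge xy. Suppose a₀a₁ and xy are edges of S_A, b₀b₁ is an edge of S_B, the points b₀, y, b₁, a₀, x occur in anticlockwise order on the circle, and a₁ lies on the closed anticlockwise arc from x to b₀. Then there exists a linkable pair (a, b) with a a vertex of S_A lying on the closed anticlockwise arc from x to a₁ and b a vertex of S_B. -/

import Mathlib

open Complex
open scoped Classical

noncomputable section

/-- The anticlockwise arc displacement from `u` to `v` on the unit circle, lying in `(0, 2π]`
(equal to `2π` when `v = u`). -/
def posArc (u v : ℂ) : ℝ :=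
  if 0 < Complex.arg (v / u) then Complex.arg (v / u) else Complex.arg (v / u) + 2 * Real.pi

/-- `u, v, w` occur in anticlockwise order on the circle. -/
def ACW (u v w : ℂ) : Prop :=
  u ≠ v ∧ v ≠ w ∧ u ≠ w ∧ posArc u v < posArc u w

/-- The open anticlockwise arc from `u` to `v`. -/
def arcOO (u v : ℂ) : Set ℂ := {x | x ≠ u ∧ x ≠ v ∧ posArc u x < posArc u v}

/-- The anticlockwise arc from `u` to `v`, open at `u` and closed at `v`. -/
def arcOC (u v : ℂ) : Set ℂ := {x | x ≠ u ∧ (x = v ∨ posArc u x < posArc u v)}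

/-- The closed anticlockwise arc from `u` to `v`. -/
def arcCC (u v : ℂ) : Set ℂ := {x | x = u ∨ x = v ∨ (x ≠ u ∧ posArc u x < posArc u v)}

/-- The (undirected) angle `∠ x v z` at apex `v`. -/
def vangle (x v z : ℂ) : ℝ := |Complex.arg ((x - v) / (z - v))|

/-- A cyclic polygon: a finite set of vertices on the unit circle together with a set of
directed edges such that every vertex has indegree and outdegree one, and any two
consecutive edges `uv`, `vw` have `u, v, w` in anticlockwise order. -/
structure CyclicPolygon where
  V : Finset ℂ
  E : Finset (ℂ × ℂ)
  nonempty : V.Nonempty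
  onCircle : ∀ v ∈ V, ‖v‖ = 1
  endmem : ∀ e ∈ E, e.1 ∈ V ∧ e.2 ∈ V
  outdeg : ∀ v ∈ V, ∃! w, (v, w) ∈ E
  indeg : ∀ v ∈ V, ∃! u, (u, v) ∈ E
  acw : ∀ u v w : ℂ, (u, v) ∈ E → (v, w) ∈ E → ACW u v w

namespace CyclicPolygon

/-- The successor `v⁺` of a vertex. -/
noncomputable def next (P : CyclicPolygon) (v : ℂ) : ℂ :=
  if h : ∃ w, (v, w) ∈ P.E then h.choose else v

/-- The predecessor `v⁻` of a vertex. -/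
noncomputable def prev (P : CyclicPolygon) (v : ℂ) : ℂ :=
  if h : ∃ u, (u, v) ∈ P.E then h.choose else v

end CyclicPolygon

/-- The interior angle `∠ v⁻ v v⁺` of `P` at `v`. -/
def interiorAngle (P : CyclicPolygon) (v : ℂ) : ℝ :=
  vangle (P.prev v) v (P.next v)

/-- The length of an edge `uv`: the number of vertices on the open anticlockwise
arc from `u` to `v`, plus one. -/
def edgeLength (P : CyclicPolygon) (u v : ℂ) : ℕ :=
  ((P.V : Set ℂ) ∩ arcOO u v).ncard + 1

/-- A `k`-star: a cyclic polygon with `2k+1` vertices all of whose edges have length `k`. -/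
def IsKStar (S : CyclicPolygon) (k : ℕ) : Prop :=
  S.V.card = 2 * k + 1 ∧ ∀ e ∈ S.E, edgeLength S e.1 e.2 = k

/-- A star: a `k`-star for some positive integer `k`. -/
def IsStar (S : CyclicPolygon) : Prop := ∃ k : ℕ, 0 < k ∧ IsKStar S k

/-- The segment from `u` to `x` splits the interior angle `∠ u⁻ u u⁺` of `S` at `u`
into the two (smaller, nonzero) angles `∠ u⁻ u x` and `∠ x u u⁺`. -/
def SplitsVertexAngle (S : CyclicPolygon) (u x : ℂ) : Prop :=
  u ∈ S.V ∧ 0 < vangle (S.prev u) u x ∧ 0 < vangle x u (S.next u) ∧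
    vangle (S.prev u) u x + vangle x u (S.next u) = vangle (S.prev u) u (S.next u)

/-- `(u, v)` is a linkable pair for the pair of cyclic polygons `(S₁, S₂)`:
the segment `uv` splits the angle of `S₁` at `u` and the angle of `S₂` at `v`. -/
def LinkablePair (S₁ S₂ : CyclicPolygon) (u v : ℂ) : Prop :=
  u ≠ v ∧ SplitsVertexAngle S₁ u v ∧ SplitsVertexAngle S₂ v u

/-- `u, v` is a linkable pair of vertices of the cyclic polygon `P`. -/
def Linkable (P : CyclicPolygon) (u v : ℂ) : Prop := LinkablePair P P u v

/-- `D` is a set of (undirected) diagonals of `P`, i.e. every member joins a linkable pair. -/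
def IsDiagonalSet (P : CyclicPolygon) (D : Set (Sym2 ℂ)) : Prop :=
  ∀ u v : ℂ, s(u, v) ∈ D → Linkable P u v

/-- The set `D̃` of directed edges associated to a set of diagonals `D`. -/
def tilde (D : Set (Sym2 ℂ)) : Set (ℂ × ℂ) := {e | s(e.1, e.2) ∈ D}

/-- The segment from `v` towards `x` splits the angle `∠ u v w`. -/
def SplitsAngle3 (u v w x : ℂ) : Prop :=
  0 < vangle u v x ∧ 0 < vangle x v w ∧ vangle u v x + vangle x v w = vangle u v w

/-- `𝒮` is a star decomposition of `P` with respect to the diagonal set `D`: the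
cycle decomposition of `E ∪ D̃` determined by `f_next` (each cycle follows the
tightest turn, i.e. no diagonal of `D` splits the angle between two consecutive
edges of a cycle), all of whose cycles are stars. -/
def IsStarDecomp (P : CyclicPolygon) (D : Set (Sym2 ℂ)) (𝒮 : Finset CyclicPolygon) : Prop :=
  IsDiagonalSet P D ∧
  (∀ S ∈ 𝒮, IsStar S ∧ (S.V : Set ℂ) ⊆ (P.V : Set ℂ)) ∧
  (∀ S ∈ 𝒮, (S.E : Set (ℂ × ℂ)) ⊆ (P.E : Set (ℂ × ℂ)) ∪ tilde D) ∧
  (∀ e ∈ (P.E : Set (ℂ × ℂ)) ∪ tilde D, ∃ S ∈ 𝒮, e ∈ S.E) ∧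
  (∀ S₁ ∈ 𝒮, ∀ S₂ ∈ 𝒮, S₁ ≠ S₂ → ∀ e : ℂ × ℂ, e ∈ S₁.E → e ∉ S₂.E) ∧
  (∀ S ∈ 𝒮, ∀ u v w : ℂ, (u, v) ∈ S.E → (v, w) ∈ S.E →
      ¬ ∃ x, s(v, x) ∈ D ∧ SplitsAngle3 u v w x)

/-- `P` admits a star decomposition with respect to `D`. -/
def HasStarDecomp (P : CyclicPolygon) (D : Set (Sym2 ℂ)) : Prop :=
  ∃ 𝒮 : Finset CyclicPolygon, IsStarDecomp P D 𝒮

/-- A maximal star decomposition: no proper superset of `D` admits a star decomposition. -/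
def IsMaximalStarDecomp (P : CyclicPolygon) (D : Set (Sym2 ℂ))
    (𝒮 : Finset CyclicPolygon) : Prop :=
  IsStarDecomp P D 𝒮 ∧ ∀ D' : Set (Sym2 ℂ), D ⊂ D' → ¬ HasStarDecomp P D'

/-- `D'` is obtained from `D` by a diagonal flip: remove one diagonal and add another. -/
def FlipStep (D D' : Set (Sym2 ℂ)) : Prop :=
  ∃ e f : Sym2 ℂ, e ∈ D ∧ f ∉ D ∧ D' = (D \ {e}) ∪ {f}

/-- The two chords `ab` and `cd` are crossing: they share no endpoint and
intersect inside the circle. -/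
def Crossing (a b c d : ℂ) : Prop :=
  a ≠ c ∧ a ≠ d ∧ b ≠ c ∧ b ≠ d ∧ (openSegment ℝ a b ∩ openSegment ℝ c d).Nonempty

/-- The two chords `ab` and `cd` share a common point: they have a common
endvertex or intersect inside the circle. -/
def ShareCommonPoint (a b c d : ℂ) : Prop :=
  a = c ∨ a = d ∨ b = c ∨ b = d ∨ (openSegment ℝ a b ∩ openSegment ℝ c d).Nonempty

/-- Two cyclic polygons have a pair of overlapped angles: a common vertex `y` and a vertex
`x` of either polygon lying on both arcs `⦅y⁺ y⁻⟧` (taken in each polygon). -/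
def OverlappedAngles (S₁ S₂ : CyclicPolygon) : Prop :=
  ∃ y : ℂ, y ∈ S₁.V ∧ y ∈ S₂.V ∧
    ∃ x : ℂ, (x ∈ S₁.V ∨ x ∈ S₂.V) ∧
      x ∈ arcOC (S₁.next y) (S₁.prev y) ∧ x ∈ arcOC (S₂.next y) (S₂.prev y)

/-- Two cyclic polygons are mutually independent: no two of their angles are overlapped. -/
def IndepPolygons (S₁ S₂ : CyclicPolygon) : Prop := ¬ OverlappedAngles S₁ S₂

/-- The edge `uv` of `P` is minimal: no edge `xy` of `P` has all vertices of the closed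
arc from `x` to `y` inside the open arc from `u` to `v`. -/
def MinimalEdge (P : CyclicPolygon) (u v : ℂ) : Prop :=
  (u, v) ∈ P.E ∧
    ¬ ∃ x y : ℂ, (x, y) ∈ P.E ∧ ∀ z ∈ P.V, z ∈ arcCC x y → z ∈ arcOO u v

/-- `vs` enumerates the star `S` as `v₀ v₁ ⋯ v₂ₖ` with `v₁ = v`, `v₀ = v⁻` (so that `v⁻v`
is an edge of `S`), each edge of `S` is an edge of `P` or a diagonal of `P`, and all the
edges `v₂ᵢ₋₁v₂ᵢ` are edges of `P`. -/
def IsBorderCandidate (P : CyclicPolygon) (v : ℂ) (S : CyclicPolygon) (k : ℕ)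
    (vs : ℕ → ℂ) : Prop :=
  0 < k ∧ IsStar S ∧ S.V.card = 2 * k + 1 ∧
  (S.V : Set ℂ) ⊆ (P.V : Set ℂ) ∧
  vs 0 = P.prev v ∧ vs 1 = v ∧ vs (2 * k + 1) = vs 0 ∧
  (∀ x ∈ S.V, ∃ i ≤ 2 * k, vs i = x) ∧
  (∀ i ≤ 2 * k, (vs i, vs (i + 1)) ∈ S.E) ∧
  (∀ i ≤ 2 * k, (vs i, vs (i + 1)) ∈ P.E ∨ Linkable P (vs i) (vs (i + 1))) ∧
  (∀ i : ℕ, 1 ≤ i → i ≤ k → (vs (2 * i - 1), vs (2 * i)) ∈ P.E)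

/-- The angle sequence `(∠v₁v₂v₃, ∠v₃v₄v₅, …, ∠v₂ₖ₋₁v₂ₖv₀)` of an enumerated star. -/
noncomputable def angleList (vs : ℕ → ℂ) (k : ℕ) : List ℝ :=
  (List.range k).map fun i => vangle (vs (2 * i + 1)) (vs (2 * i + 2)) (vs (2 * i + 3))

/-- `S` is the border star `S*(P, v)`: among all border candidates, its angle sequence is
lexicographically minimal. -/
def IsBorderStar (P : CyclicPolygon) (v : ℂ) (S : CyclicPolygon) : Prop :=
  ∃ (k : ℕ) (vs : ℕ → ℂ), IsBorderCandidate P v S k vs ∧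
    ∀ (S' : CyclicPolygon) (k' : ℕ) (vs' : ℕ → ℂ), IsBorderCandidate P v S' k' vs' →
      ¬ List.Lex (· < ·) (angleList vs' k') (angleList vs k)


/-! ### Arc geometry -/

lemma posArc_pos (u v : ℂ) : 0 < posArc u v := by
  unfold posArc
  split_ifs with h
  · exact h
  · have := Complex.neg_pi_lt_arg (v / u)
    linarith [Real.pi_pos]

lemma posArc_le (u v : ℂ) : posArc u v ≤ 2 * Real.pi := by
  unfold posArc
  split_ifs with h
  · have := Complex.arg_le_pi (v / u)
    linarith [Real.pi_pos]
  · push Not at h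
    linarith

lemma posArc_spec {u v : ℂ} (hu : ‖u‖ = 1) (hv : ‖v‖ = 1) :
    v = u * Complex.exp ((posArc u v : ℝ) * I) := by
  have hu0 : u ≠ 0 := by
    intro h0
    simp [h0] at hu
  have h1 : v / u = Complex.exp ((Complex.arg (v / u) : ℝ) * I) := by
    have := Complex.norm_mul_exp_arg_mul_I (v / u)
    rw [norm_div, hu, hv] at this
    simpa using this.symm
  have h2 : Complex.exp ((posArc u v : ℝ) * I) = v / u := by
    unfold posArc
    split_ifs with h
    · exact h1.symm
    · push_cast
      rw [add_mul, Complex.exp_add, Complex.exp_two_pi_mul_I, mul_one]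
      exact h1.symm
  rw [h2]
  field_simp

lemma exp_eq_of_lt {s t : ℝ} (h : Complex.exp (s * I) = Complex.exp (t * I))
    (h1 : s - t < 2 * Real.pi) (h2 : t - s < 2 * Real.pi) : s = t := by
  rw [Complex.exp_eq_exp_iff_exists_int] at h
  obtain ⟨n, hn⟩ := h
  have h3 : (s : ℂ) = t + n * (2 * Real.pi) := by
    have : (s : ℂ) * I = (t + n * (2 * Real.pi)) * I := by
      rw [hn]
      ring
    exact mul_right_cancel₀ Complex.I_ne_zero this
  have h4 : s = t + n * (2 * Real.pi) := by exact_mod_cast h3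
  have hp := Real.pi_pos
  have h5 : (n : ℝ) < 1 := by
    by_contra hc
    push Not at hc
    nlinarith
  have h6 : (-1 : ℝ) < n := by
    by_contra hc
    push Not at hc
    nlinarith
  have h7 : n < 1 := by exact_mod_cast h5
  have h8 : -1 < n := by exact_mod_cast h6
  have h9 : n = 0 := by omega
  rw [h4, h9]
  simp

lemma posArc_unique {u v : ℂ} {t : ℝ} (hu : ‖u‖ = 1) (hv : ‖v‖ = 1) (h0 : 0 < t)
    (h1 : t ≤ 2 * Real.pi) (h : v = u * Complex.exp (t * I)) : posArc u v = t := by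
  have hu0 : u ≠ 0 := by
    intro h0
    simp [h0] at hu
  have h2 := posArc_spec hu hv
  have h3 : Complex.exp ((posArc u v : ℝ) * I) = Complex.exp (t * I) :=
    mul_left_cancel₀ hu0 (h2.symm.trans h)
  have := posArc_pos u v
  have := posArc_le u v
  exact exp_eq_of_lt h3 (by linarith) (by linarith)

lemma posArc_lt {u v : ℂ} (hu : ‖u‖ = 1) (hv : ‖v‖ = 1) (h : v ≠ u) :
    posArc u v < 2 * Real.pi := by
  rcases lt_or_eq_of_le (posArc_le u v) with h1 | h1
  · exact h1
  · exfalso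
    have h2 := posArc_spec hu hv
    rw [h1] at h2
    push_cast at h2
    rw [Complex.exp_two_pi_mul_I, mul_one] at h2
    exact h h2

/-- The angular coordinate in `[0, 2π)` measured from `x`. -/
def crd (x z : ℂ) : ℝ := if z = x then 0 else posArc x z

lemma crd_self (x : ℂ) : crd x x = 0 := by simp [crd]

lemma crd_nonneg (x z : ℂ) : 0 ≤ crd x z := by
  unfold crd
  split_ifs
  · exact le_rfl
  · exact (posArc_pos x z).le

lemma crd_lt {x z : ℂ} (hx : ‖x‖ = 1) (hz : ‖z‖ = 1) : crd x z < 2 * Real.pi := by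
  unfold crd
  split_ifs with h
  · linarith [Real.pi_pos]
  · exact posArc_lt hx hz h

lemma crd_spec {x z : ℂ} (hx : ‖x‖ = 1) (hz : ‖z‖ = 1) :
    z = x * Complex.exp ((crd x z : ℝ) * I) := by
  unfold crd
  split_ifs with h
  · simp [h]
  · exact posArc_spec hx hz

lemma crd_inj {x u v : ℂ} (hx : ‖x‖ = 1) (hu : ‖u‖ = 1) (hv : ‖v‖ = 1)
    (h : crd x u = crd x v) : u = v := by
  rw [crd_spec hx hu, crd_spec hx hv, h]

lemma posArc_of_lt {x u v : ℂ} (hx : ‖x‖ = 1) (hu : ‖u‖ = 1) (hv : ‖v‖ = 1)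
    (h : crd x u < crd x v) : posArc u v = crd x v - crd x u := by
  have h1 := crd_nonneg x u
  have h2 := crd_lt hx hv
  apply posArc_unique hu hv (by linarith) (by linarith)
  refine (crd_spec hx hv).trans (Eq.symm ((congrArg (· * _) (crd_spec hx hu)).trans ?_))
  rw [mul_assoc, ← Complex.exp_add]
  congr 2
  push_cast
  ring

lemma posArc_of_le {x u v : ℂ} (hx : ‖x‖ = 1) (hu : ‖u‖ = 1) (hv : ‖v‖ = 1)
    (h : crd x v ≤ crd x u) : posArc u v = crd x v - crd x u + 2 * Real.pi := by
  have h1 := crd_nonneg x v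
  have h2 := crd_lt hx hu
  apply posArc_unique hu hv (by linarith) (by linarith)
  refine (crd_spec hx hv).trans (Eq.symm ((congrArg (· * _) (crd_spec hx hu)).trans ?_))
  rw [mul_assoc, ← Complex.exp_add]
  have : (crd x u : ℂ) * I + ((crd x v - crd x u + 2 * Real.pi : ℝ) : ℂ) * I
      = (crd x v : ℂ) * I + 2 * Real.pi * I := by
    push_cast
    ring
  rw [this, Complex.exp_add, Complex.exp_two_pi_mul_I, mul_one]

lemma exp_sub_one (t : ℝ) : Complex.exp (t * I) - 1
    = ((2 * Real.sin (t / 2) : ℝ) : ℂ) * (I * Complex.exp ((t / 2 : ℝ) * I)) := by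
  have h1 : Complex.exp (t * I) = Complex.exp ((t / 2 : ℝ) * I) * Complex.exp ((t / 2 : ℝ) * I) := by
    rw [← Complex.exp_add]
    congr 1
    push_cast
    ring
  have h2 : Complex.exp ((t / 2 : ℝ) * I) = Complex.cos (t / 2 : ℝ) + Complex.sin (t / 2 : ℝ) * I :=
    Complex.exp_mul_I _
  have h3 := Complex.sin_sq_add_cos_sq ((t / 2 : ℝ) : ℂ)
  rw [h1, h2]
  push_cast at *
  linear_combination (1 : ℂ) * h3 + (Complex.sin (t/2) ^ 2 - 2 * Complex.sin (t/2)^2) * Complex.I_sq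

lemma vangle_eq {v a b : ℂ} (hv : ‖v‖ = 1) (ha : ‖a‖ = 1) (hb : ‖b‖ = 1) (hav : a ≠ v)
    (hbv : b ≠ v) : vangle a v b = |posArc v a - posArc v b| / 2 := by
  have hv0 : v ≠ 0 := by
    intro h0
    simp [h0] at hv
  have a1 := posArc_pos v a
  have a2 := posArc_lt hv ha hav
  have b1 := posArc_pos v b
  have b2 := posArc_lt hv hb hbv
  have sa : 0 < Real.sin (posArc v a / 2) := Real.sin_pos_of_pos_of_lt_pi (by linarith) (by linarith)
  have sb : 0 < Real.sin (posArc v b / 2) := Real.sin_pos_of_pos_of_lt_pi (by linarith) (by linarith)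
  have key : (a - v) / (b - v) = ((Real.sin (posArc v a / 2) / Real.sin (posArc v b / 2) : ℝ) : ℂ) *
      Complex.exp (((posArc v a - posArc v b) / 2 : ℝ) * I) := by
    have e1 : a - v = v * (Complex.exp ((posArc v a : ℝ) * I) - 1) := by
      rw [mul_sub, ← posArc_spec hv ha, mul_one]
    have e2 : b - v = v * (Complex.exp ((posArc v b : ℝ) * I) - 1) := by
      rw [mul_sub, ← posArc_spec hv hb, mul_one]
    have e3 : Complex.exp (((posArc v a - posArc v b) / 2 : ℝ) * I) =
        Complex.exp ((posArc v a / 2 : ℝ) * I) / Complex.exp ((posArc v b / 2 : ℝ) * I) := by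
      rw [← Complex.exp_sub]
      congr 1
      push_cast
      ring
    rw [e1, e2, exp_sub_one, exp_sub_one, e3]
    have sb' : ((Real.sin (posArc v b / 2) : ℝ) : ℂ) ≠ 0 := by exact_mod_cast sb.ne'
    have := Complex.exp_ne_zero ((posArc v b / 2 : ℝ) * I)
    have := Complex.I_ne_zero
    rw [Complex.ofReal_mul, Complex.ofReal_mul, Complex.ofReal_div
      (Real.sin (posArc v a / 2))]
    field_simp
  unfold vangle
  rw [key, Complex.arg_real_mul _ (div_pos sa sb), Complex.arg_exp_mul_I, 
    (toIocMod_eq_self (by positivity)).2 ⟨by linarith, by linarith⟩, abs_div]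
  norm_num

/-- Betweenness gives angle splitting. -/
lemma splits_of_between {p v w z : ℂ} (hv : ‖v‖ = 1) (hp : ‖p‖ = 1) (hw : ‖w‖ = 1)
    (hz : ‖z‖ = 1) (hpv : p ≠ v) (hwv : w ≠ v) (hzv : z ≠ v)
    (h1 : posArc v w < posArc v z) (h2 : posArc v z < posArc v p) :
    0 < vangle p v z ∧ 0 < vangle z v w ∧ vangle p v z + vangle z v w = vangle p v w := by
  rw [vangle_eq hv hp hz hpv hzv, vangle_eq hv hz hw hzv hwv, vangle_eq hv hp hw hpv hwv,
    abs_of_pos (by linarith), abs_of_pos (by linarith), abs_of_pos (by linarith)]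
  refine ⟨by linarith, by linarith, by linarith⟩

/-- Angle splitting gives betweenness. -/
lemma between_of_splits {p v w z : ℂ} (hv : ‖v‖ = 1) (hp : ‖p‖ = 1) (hw : ‖w‖ = 1)
    (hz : ‖z‖ = 1) (hpv : p ≠ v) (hwv : w ≠ v) (hzv : z ≠ v)
    (hwp : posArc v w < posArc v p)
    (h1 : 0 < vangle p v z) (h2 : 0 < vangle z v w)
    (h3 : vangle p v z + vangle z v w = vangle p v w) :
    posArc v w < posArc v z ∧ posArc v z < posArc v p := by
  rw [vangle_eq hv hp hz hpv hzv] at h1 h3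
  rw [vangle_eq hv hz hw hzv hwv] at h2 h3
  rw [vangle_eq hv hp hw hpv hwv, abs_of_pos (a := posArc v p - posArc v w) (by linarith)] at h3
  constructor
  · by_contra hc
    push Not at hc
    rw [abs_of_pos (a := posArc v p - posArc v z) (by linarith)] at h3
    linarith
  · by_contra hc
    push Not at hc
    rw [abs_of_pos (a := posArc v z - posArc v w) (by linarith)] at h3
    linarith

/-! ### Basic facts on cyclic polygons -/

lemma CyclicPolygon.next_eq (S : CyclicPolygon) {u v : ℂ} (h : (u, v) ∈ S.E) : S.next u = v := by
  have hex : ∃ w, (u, w) ∈ S.E := ⟨v, h⟩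
  unfold CyclicPolygon.next
  rw [dif_pos hex]
  exact (S.outdeg u (S.endmem _ h).1).unique hex.choose_spec h

lemma CyclicPolygon.prev_eq (S : CyclicPolygon) {u v : ℂ} (h : (u, v) ∈ S.E) : S.prev v = u := by
  have hex : ∃ w, (w, v) ∈ S.E := ⟨u, h⟩
  unfold CyclicPolygon.prev
  rw [dif_pos hex]
  exact (S.indeg v (S.endmem _ h).2).unique hex.choose_spec h

lemma CyclicPolygon.exists_nbrs (S : CyclicPolygon) {v : ℂ} (h : v ∈ S.V) :
    ∃ p w, (p, v) ∈ S.E ∧ (v, w) ∈ S.E := by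
  obtain ⟨p, hp, -⟩ := S.indeg v h
  obtain ⟨w, hw, -⟩ := S.outdeg v h
  exact ⟨p, w, hp, hw⟩

lemma CyclicPolygon.edge_facts (S : CyclicPolygon) {p v w : ℂ} (h1 : (p, v) ∈ S.E)
    (h2 : (v, w) ∈ S.E) : ‖p‖ = 1 ∧ ‖v‖ = 1 ∧ ‖w‖ = 1 ∧ p ≠ v ∧ w ≠ v ∧
      posArc v w < posArc v p := by
  have hp := S.onCircle _ (S.endmem _ h1).1
  have hv := S.onCircle _ (S.endmem _ h1).2
  have hw := S.onCircle _ (S.endmem _ h2).2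
  obtain ⟨n1, n2, n3, h⟩ := S.acw p v w h1 h2
  simp only at hp hv hw
  refine ⟨hp, hv, hw, n1, n2.symm, ?_⟩
  have e0 : crd p p < crd p v := by
    rw [crd_self, crd, if_neg n1.symm]
    exact posArc_pos _ _
  have e1 : crd p v < crd p w := by
    rw [crd, if_neg n1.symm, crd, if_neg n3.symm]
    exact h
  rw [posArc_of_lt hp hv hw e1, posArc_of_le hp hv hp e0.le, crd_self]
  have := crd_lt hp hw
  linarith

lemma splitsVertex_of_between (S : CyclicPolygon) {p v w z : ℂ} (h1 : (p, v) ∈ S.E)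
    (h2 : (v, w) ∈ S.E) (hz : ‖z‖ = 1) (hzv : z ≠ v) (h3 : posArc v w < posArc v z)
    (h4 : posArc v z < posArc v p) : SplitsVertexAngle S v z := by
  obtain ⟨hp, hv, hw, n1, n2, -⟩ := S.edge_facts h1 h2
  refine ⟨(S.endmem _ h1).2, ?_⟩
  rw [S.next_eq h2, S.prev_eq h1]
  exact splits_of_between hv hp hw hz n1 n2 hzv h3 h4

lemma between_of_splitsVertex (S : CyclicPolygon) {p v w z : ℂ} (h1 : (p, v) ∈ S.E)
    (h2 : (v, w) ∈ S.E) (hz : ‖z‖ = 1) (hzv : z ≠ v) (h : SplitsVertexAngle S v z) :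
    posArc v w < posArc v z ∧ posArc v z < posArc v p := by
  obtain ⟨hp, hv, hw, n1, n2, n3⟩ := S.edge_facts h1 h2
  obtain ⟨-, h⟩ := h
  rw [S.next_eq h2, S.prev_eq h1] at h
  exact between_of_splits hv hp hw hz n1 n2 hzv n3 h.1 h.2.1 h.2.2

/-- A diagonal at `v` lies strictly inside the angle of `P` at `v`. -/
lemma diag_between {P : CyclicPolygon} {D : Set (Sym2 ℂ)} (hD : IsDiagonalSet P D)
    {p v w z : ℂ} (h1 : (p, v) ∈ P.E) (h2 : (v, w) ∈ P.E) (hz : s(v, z) ∈ D) :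
    z ∈ P.V ∧ z ≠ v ∧ posArc v w < posArc v z ∧ posArc v z < posArc v p := by
  obtain ⟨n, s1, s2⟩ := hD v z hz
  have hzV : z ∈ P.V := s2.1
  exact ⟨hzV, n.symm, between_of_splitsVertex P h1 h2 (P.onCircle z hzV) n.symm s1⟩

/-- No edge or diagonal at `v` lies strictly inside an angle of a star of the decomposition. -/
lemma not_inside {P : CyclicPolygon} {D : Set (Sym2 ℂ)} {𝒮 : Finset CyclicPolygon}
    (h : IsStarDecomp P D 𝒮) {S : CyclicPolygon} (hS : S ∈ 𝒮) {p v w z : ℂ}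
    (h1 : (p, v) ∈ S.E) (h2 : (v, w) ∈ S.E)
    (hz : (v, z) ∈ (P.E : Set (ℂ × ℂ)) ∪ tilde D ∨ (z, v) ∈ (P.E : Set (ℂ × ℂ)) ∪ tilde D)
    (h3 : posArc v w < posArc v z) (h4 : posArc v z < posArc v p) : False := by
  obtain ⟨hD, hst, hsub, -, -, hno⟩ := h
  obtain ⟨hp, hv, hw, n1, n2, -⟩ := S.edge_facts h1 h2
  have hvP : v ∈ P.V := (hst S hS).2 (S.endmem _ h1).2
  obtain ⟨p', w', hp', hw'⟩ := P.exists_nbrs hvP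
  have hdiag : s(v, z) ∈ D → False := by
    intro hd
    obtain ⟨zV, zv, -⟩ := diag_between hD hp' hw' hd
    exact hno S hS p v w h1 h2 ⟨z, hd,
      splits_of_between hv hp hw (P.onCircle z zV) n1 n2 zv h3 h4⟩
  rcases hz with (hz | hz) | (hz | hz)
  · rcases hsub S hS h2 with h5 | h5
    · have : w = z := (P.outdeg v hvP).unique h5 hz
      rw [this] at h3
      exact lt_irrefl _ h3
    · have := (diag_between hD hp' hz h5).2.2.1
      linarith
  · exact hdiag hz
  · rcases hsub S hS h1 with h5 | h5
    · have : p = z := (P.indeg v hvP).unique h5 hz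
      rw [this] at h4
      exact lt_irrefl _ h4
    · have h5' : s(v, p) ∈ D := by
        rw [Sym2.eq_swap]
        exact h5
      have := (diag_between hD hz hw' h5').2.2.2
      linarith
  · apply hdiag
    rw [Sym2.eq_swap]
    exact hz

/-! ### Indexing a star by the cyclic order from a base point -/

lemma star_index {S : CyclicPolygon} {k : ℕ} (hS : IsKStar S k) {x : ℂ}
    (hx : ‖x‖ = 1) : ∃ f : ℕ → ℂ, (∀ i ≤ 2 * k, f i ∈ S.V) ∧
      (∀ v ∈ S.V, ∃ i ≤ 2 * k, f i = v) ∧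
      (∀ i m, i < m → m ≤ 2 * k → crd x (f i) < crd x (f m)) ∧
      (∀ i ≤ k, (f i, f (i + k)) ∈ S.E) ∧ (∀ i < k, (f (i + k + 1), f i) ∈ S.E) := by
  obtain ⟨hcard, hlen⟩ := hS
  have hT : (S.V.image (crd x)).card = 2 * k + 1 := by
    rw [Finset.card_image_of_injOn, hcard]
    intro u hu v hv huv
    exact crd_inj hx (S.onCircle u hu) (S.onCircle v hv) huv
  have hex : ∀ i : ℕ, ∃ v : ℂ, ∀ h : i < 2 * k + 1,
      v ∈ S.V ∧ crd x v = (S.V.image (crd x)).orderEmbOfFin hT ⟨i, h⟩ := by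
    intro i
    by_cases h : i < 2 * k + 1
    · have := Finset.orderEmbOfFin_mem (S.V.image (crd x)) hT ⟨i, h⟩
      obtain ⟨v, hv, he⟩ := Finset.mem_image.1 this
      exact ⟨v, fun _ => ⟨hv, he⟩⟩
    · exact ⟨0, fun h' => absurd h' h⟩
  choose f hf using hex
  have hV : ∀ i ≤ 2 * k, f i ∈ S.V := fun i hi => (hf i (by omega)).1
  have hmono : ∀ i m, i < m → m ≤ 2 * k → crd x (f i) < crd x (f m) := by
    intro i m h1 h2
    rw [(hf i (by omega)).2, (hf m (by omega)).2]
    exact (Finset.orderEmbOfFin _ hT).strictMono (by simpa using h1)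
  have hsurj : ∀ v ∈ S.V, ∃ i ≤ 2 * k, f i = v := by
    intro v hv
    have h1 : crd x v ∈ Set.range ((S.V.image (crd x)).orderEmbOfFin hT) := by
      rw [Finset.range_orderEmbOfFin]
      exact Finset.mem_coe.2 (Finset.mem_image_of_mem _ hv)
    obtain ⟨i, hi⟩ := h1
    refine ⟨i, by omega, ?_⟩
    apply crd_inj hx (S.onCircle _ (hV i (by omega))) (S.onCircle v hv)
    rw [(hf i i.2).2, ← hi]
  have hle : ∀ i m, i ≤ m → m ≤ 2 * k → crd x (f i) ≤ crd x (f m) := by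
    intro i m h1 h2
    rcases h1.lt_or_eq with h | h
    · exact (hmono i m h h2).le
    · rw [h]
  have hlt : ∀ i m, i ≤ 2 * k → m ≤ 2 * k → crd x (f i) < crd x (f m) → i < m := by
    intro i m h1 h2 h3
    by_contra hc
    have := hle m i (by omega) h1
    linarith
  have hinj : ∀ i m, i ≤ 2 * k → m ≤ 2 * k → f i = f m → i = m := by
    intro i m h1 h2 h3
    rcases lt_trichotomy i m with h | h | h
    · have := hmono i m h h2
      rw [h3] at this
      exact absurd this (lt_irrefl _)
    · exact h
    · have := hmono m i h h1
      rw [h3] at this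
      exact absurd this (lt_irrefl _)
  have hu : ∀ i ≤ 2 * k, ‖f i‖ = 1 := fun i hi => S.onCircle _ (hV i hi)
  have hncard : ∀ A : Finset ℕ, (∀ a ∈ A, a ≤ 2 * k) → (f '' (A : Set ℕ)).ncard = A.card := by
    intro A hA
    rw [Set.InjOn.ncard_image, Set.ncard_coe_finset]
    intro a ha b hb hab
    exact hinj a b (hA a ha) (hA b hb) hab
  -- the index of the head of an edge
  have hedge : ∀ i m, i ≤ 2 * k → m ≤ 2 * k → (f i, f m) ∈ S.E →
      (i < m ∧ m = i + k) ∨ (m < i ∧ i = m + k + 1) := by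
    intro i m hi hm he
    have hl := hlen _ he
    unfold edgeLength at hl
    simp only at hl
    rcases lt_trichotomy i m with h | h | h
    · left
      have hset : (S.V : Set ℂ) ∩ arcOO (f i) (f m) = f '' ((Finset.Ioo i m : Finset ℕ) : Set ℕ) := by
        ext z
        constructor
        · rintro ⟨hz, hz1, hz2, hz3⟩
          obtain ⟨n, hn, rfl⟩ := hsurj z hz
          refine ⟨n, ?_, rfl⟩
          rw [posArc_of_lt hx (hu i hi) (hu m hm) (hmono i m h hm)] at hz3
          have c1 := crd_lt hx (hu m hm)
          have c2 := crd_nonneg x (f n)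
          have hin : crd x (f i) < crd x (f n) := by
            by_contra hc
            push Not at hc
            rw [posArc_of_le hx (hu i hi) (hu n hn) hc] at hz3
            linarith
          rw [posArc_of_lt hx (hu i hi) (hu n hn) hin] at hz3
          simp only [Finset.coe_Ioo, Set.mem_Ioo]
          exact ⟨hlt _ _ hi hn hin, hlt _ _ hn hm (by linarith)⟩
        · rintro ⟨n, hn, rfl⟩
          simp only [Finset.coe_Ioo, Set.mem_Ioo] at hn
          have hn' : n ≤ 2 * k := by omega
          refine ⟨hV n hn', ?_, ?_, ?_⟩
          · intro hc
            have := hinj _ _ hn' hi hc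
            omega
          · intro hc
            have := hinj _ _ hn' hm hc
            omega
          · rw [posArc_of_lt hx (hu i hi) (hu m hm) (hmono i m h hm),
              posArc_of_lt hx (hu i hi) (hu n hn') (hmono i n hn.1 hn')]
            linarith [hmono n m hn.2 hm]
      rw [hset, hncard _ (by intro a ha; simp at ha; omega), Nat.card_Ioo] at hl
      omega
    · exfalso
      rw [h] at he
      obtain ⟨p, w, hp, hw⟩ := S.exists_nbrs (hV m hm)
      have e1 := S.next_eq he
      have e2 := (S.edge_facts hp he).2.2.2.2.1
      exact e2 rfl
    · right
      have hset : (S.V : Set ℂ) ∩ arcOO (f i) (f m)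
          = f '' ((Finset.range (2 * k + 1) \ Finset.Icc m i : Finset ℕ) : Set ℕ) := by
        ext z
        constructor
        · rintro ⟨hz, hz1, hz2, hz3⟩
          obtain ⟨n, hn, rfl⟩ := hsurj z hz
          refine ⟨n, ?_, rfl⟩
          have hni : n ≠ i := fun hc => hz1 (by rw [hc])
          have hnm : n ≠ m := fun hc => hz2 (by rw [hc])
          rw [posArc_of_le hx (hu i hi) (hu m hm) (hmono m i h hi).le] at hz3
          simp only [Finset.coe_sdiff, Finset.coe_range, Finset.coe_Icc, Set.mem_sdiff,
            Set.mem_Iio, Set.mem_Icc]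
          refine ⟨by omega, ?_⟩
          rintro ⟨g1, g2⟩
          rw [posArc_of_le hx (hu i hi) (hu n hn) (hle n i g2 hi)] at hz3
          have := hmono m n (by omega) hn
          linarith
        · rintro ⟨n, hn, rfl⟩
          simp only [Finset.coe_sdiff, Finset.coe_range, Finset.coe_Icc, Set.mem_sdiff,
            Set.mem_Iio, Set.mem_Icc] at hn
          have hn' : n ≤ 2 * k := by omega
          refine ⟨hV n hn', ?_, ?_, ?_⟩
          · intro hc
            have := hinj _ _ hn' hi hc
            omega
          · intro hc
            have := hinj _ _ hn' hm hc
            omega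
          · rw [posArc_of_le hx (hu i hi) (hu m hm) (hmono m i h hi).le]
            rcases lt_or_ge i n with h1 | h1
            · rw [posArc_of_lt hx (hu i hi) (hu n hn') (hmono i n h1 hn')]
              have := crd_lt hx (hu n hn')
              have := crd_nonneg x (f m)
              linarith
            · rw [posArc_of_le hx (hu i hi) (hu n hn') (hle n i h1 hi)]
              have := hmono n m (by omega) hm
              linarith
      rw [hset, hncard _ (by intro a ha; simp at ha; omega),
        Finset.card_sdiff_of_subset (by intro a ha; simp at ha ⊢; omega),
        Nat.card_Icc, Finset.card_range] at hl
      omega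
  refine ⟨f, hV, hsurj, hmono, ?_, ?_⟩
  · intro i hi
    obtain ⟨w, hw, -⟩ := S.outdeg _ (hV i (by omega))
    obtain ⟨m, hm, rfl⟩ := hsurj w (S.endmem _ hw).2
    rcases hedge i m (by omega) hm hw with h | h
    · rw [← h.2]
      exact hw
    · omega
  · intro i hi
    obtain ⟨w, hw, -⟩ := S.outdeg _ (hV (i + k + 1) (by omega))
    obtain ⟨m, hm, rfl⟩ := hsurj w (S.endmem _ hw).2
    rcases hedge (i + k + 1) m (by omega) hm hw with h | h
    · omega
    · have : m = i := by omega
      rw [← this]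
      rw [← this] at hw
      exact hw

/-! ### Consequences of minimality -/

lemma lt_of_posArc_lt {x u w v : ℂ} (hx : ‖x‖ = 1) (hu : ‖u‖ = 1) (hw : ‖w‖ = 1)
    (hv : ‖v‖ = 1) (huv : crd x u < crd x v) (h : posArc u w < posArc u v) :
    crd x u < crd x w ∧ crd x w < crd x v := by
  have c1 := crd_lt hx hv
  have c2 := crd_nonneg x w
  rw [posArc_of_lt hx hu hv huv] at h
  have h1 : crd x u < crd x w := by
    by_contra hc
    push Not at hc
    rw [posArc_of_le hx hu hw hc] at h
    linarith
  rw [posArc_of_lt hx hu hw h1] at h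
  exact ⟨h1, by linarith⟩

lemma crd_pos {x z : ℂ} (h : z ≠ x) : 0 < crd x z := by
  rw [crd, if_neg h]
  exact posArc_pos _ _

lemma no_inner_edge {P : CyclicPolygon} {x y u v : ℂ} (hxy : MinimalEdge P x y)
    (he : (u, v) ∈ P.E) (hne : (u, v) ≠ (x, y)) (h1 : crd x u < crd x v)
    (h2 : crd x v ≤ crd x y) : False := by
  obtain ⟨hE, hmin⟩ := hxy
  have hxV : x ∈ P.V := (P.endmem _ hE).1
  have hyV : y ∈ P.V := (P.endmem _ hE).2
  have huV : u ∈ P.V := (P.endmem _ he).1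
  have hvV : v ∈ P.V := (P.endmem _ he).2
  have hx := P.onCircle x hxV
  have hy := P.onCircle y hyV
  have hu := P.onCircle u huV
  have hv := P.onCircle v hvV
  have hux : u ≠ x := by
    rintro rfl
    exact hne (by rw [(P.outdeg u huV).unique he hE])
  have hvy : v ≠ y := by
    rintro rfl
    exact hne (by rw [(P.indeg v hvV).unique he hE])
  have hvy' : crd x v < crd x y := lt_of_le_of_ne h2 (fun hc => hvy (crd_inj hx hv hy hc))
  have hu0 := crd_pos hux
  apply hmin
  refine ⟨u, v, he, ?_⟩
  intro z hzV hz
  have hzc := P.onCircle z hzV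
  have hb : crd x u ≤ crd x z ∧ crd x z ≤ crd x v := by
    rcases hz with rfl | rfl | ⟨-, hz⟩
    · exact ⟨le_rfl, h1.le⟩
    · exact ⟨h1.le, le_rfl⟩
    · have := lt_of_posArc_lt hx hu hzc hv h1 hz
      exact ⟨this.1.le, this.2.le⟩
  have hzx : z ≠ x := by
    rintro rfl
    rw [crd_self] at hb
    linarith
  have hyx : y ≠ x := by
    rintro rfl
    rw [crd_self] at hvy'
    linarith
  refine ⟨hzx, ?_, ?_⟩
  · rintro rfl
    linarith
  · have : crd x z < crd x y := by linarith
    rwa [crd, if_neg hzx, crd, if_neg hyx] at this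

lemma no_inner {P : CyclicPolygon} {D : Set (Sym2 ℂ)} (hD : IsDiagonalSet P D)
    {x y u v : ℂ} (hxy : MinimalEdge P x y)
    (he : (u, v) ∈ (P.E : Set (ℂ × ℂ)) ∪ tilde D) (hne : (u, v) ≠ (x, y))
    (huV : u ∈ P.V) (h1 : crd x u < crd x v) (h2 : crd x v ≤ crd x y) : False := by
  rcases he with he | he
  · exact no_inner_edge hxy he hne h1 h2
  · obtain ⟨p, w, hp, hw⟩ := P.exists_nbrs huV
    obtain ⟨hvV, -, h3, -⟩ := diag_between hD hp hw he
    have hx := P.onCircle x (P.endmem _ hxy.1).1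
    have := lt_of_posArc_lt hx (P.onCircle u huV) (P.onCircle w (P.endmem _ hw).2)
      (P.onCircle v hvV) h1 h3
    refine no_inner_edge hxy hw ?_ this.1 (by linarith)
    intro hc
    have hwy : w = y := congrArg Prod.snd hc
    have h4 := this.2
    rw [hwy] at h4
    linarith

/-- Let `S_A` and `S_B` be distinct stars of a star decomposition of a cyclic
polygon `P` with a minimal edge `xy`. If `a₀a₁` and `xy` are edges of `S_A`, `b₀b₁` is an edge
of `S_B`, the points `b₀, y, b₁, a₀, x` occur in anticlockwise order, and `a₁` lies on the
closed anticlockwise arc from `x` to `b₀`, then there is a linkable pair `(a, b)` of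
`(S_A, S_B)` with `a` on the closed anticlockwise arc from `x` to `a₁`. -/
theorem find_linkable_pair (P : CyclicPolygon) (D : Set (Sym2 ℂ)) (𝒮 : Finset CyclicPolygon)
    (h : IsStarDecomp P D 𝒮) (SA SB : CyclicPolygon) (hA : SA ∈ 𝒮) (hB : SB ∈ 𝒮)
    (hAB : SA ≠ SB) (x y a₀ a₁ b₀ b₁ : ℂ)
    (hxy : MinimalEdge P x y)
    (ha : (a₀, a₁) ∈ SA.E) (hxyA : (x, y) ∈ SA.E) (hb : (b₀, b₁) ∈ SB.E)
    (horder : b₀ ≠ x ∧ posArc b₀ y < posArc b₀ b₁ ∧ posArc b₀ b₁ < posArc b₀ a₀ ∧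
      posArc b₀ a₀ < posArc b₀ x)
    (ha₁ : a₁ ∈ arcCC x b₀) :
    ∃ a b : ℂ, a ∈ SA.V ∧ b ∈ SB.V ∧ a ∈ arcCC x a₁ ∧ LinkablePair SA SB a b := by
  have h' := h
  obtain ⟨hD, hst, hsub, -, hdisj, -⟩ := h'
  obtain ⟨⟨k, hk, hkA⟩, hAV⟩ := hst SA hA
  obtain ⟨⟨l, hl, hlB⟩, hBV⟩ := hst SB hB
  obtain ⟨hb0x, ho1, ho2, ho3⟩ := horder
  have hxV : x ∈ SA.V := (SA.endmem _ hxyA).1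
  have hx : ‖x‖ = 1 := SA.onCircle x hxV
  have hy : ‖y‖ = 1 := SA.onCircle y (SA.endmem _ hxyA).2
  have hca0 : ‖a₀‖ = 1 := SA.onCircle a₀ (SA.endmem _ ha).1
  have hca1 : ‖a₁‖ = 1 := SA.onCircle a₁ (SA.endmem _ ha).2
  have hcb0 : ‖b₀‖ = 1 := SB.onCircle b₀ (SB.endmem _ hb).1
  have hcb1 : ‖b₁‖ = 1 := SB.onCircle b₁ (SB.endmem _ hb).2
  -- coordinates of the given points
  have hb0pos : 0 < crd x b₀ := crd_pos hb0x
  have hpx : posArc b₀ x = 2 * Real.pi - crd x b₀ := by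
    rw [posArc_of_le hx hcb0 hx (by rw [crd_self]; exact hb0pos.le), crd_self]
    ring
  rw [hpx] at ho3
  have hgt : ∀ z : ℂ, ‖z‖ = 1 → posArc b₀ z < 2 * Real.pi - crd x b₀ →
      crd x b₀ < crd x z ∧ posArc b₀ z = crd x z - crd x b₀ := by
    intro z hz hlt
    have h1 : crd x b₀ < crd x z := by
      by_contra hc
      push Not at hc
      rw [posArc_of_le hx hcb0 hz hc] at hlt
      linarith [crd_nonneg x z]
    exact ⟨h1, posArc_of_lt hx hcb0 hz h1⟩
  obtain ⟨ga0, ea0⟩ := hgt a₀ hca0 ho3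
  obtain ⟨gb1, eb1⟩ := hgt b₁ hcb1 (by linarith)
  obtain ⟨gy, ey⟩ := hgt y hy (by linarith)
  have oyb : crd x y < crd x b₁ := by linarith
  have oba : crd x b₁ < crd x a₀ := by linarith
  have oa1 : crd x a₁ ≤ crd x b₀ := by
    rcases ha₁ with hc | hc | ⟨hc, hc2⟩
    · rw [hc, crd_self]
      exact hb0pos.le
    · rw [hc]
    · rw [crd, if_neg hc, crd, if_neg hb0x]
      exact hc2.le
  -- index the two stars
  obtain ⟨f, fV, fsurj, fmono, fE1, fE2⟩ := star_index hkA hx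
  obtain ⟨g, gV, gsurj, gmono, gE1, gE2⟩ := star_index hlB hx
  have fle : ∀ i m, i ≤ m → m ≤ 2 * k → crd x (f i) ≤ crd x (f m) := by
    intro i m h1 h2
    rcases h1.lt_or_eq with h | h
    · exact (fmono i m h h2).le
    · rw [h]
  have gle : ∀ i m, i ≤ m → m ≤ 2 * l → crd x (g i) ≤ crd x (g m) := by
    intro i m h1 h2
    rcases h1.lt_or_eq with h | h
    · exact (gmono i m h h2).le
    · rw [h]
  have fc : ∀ i ≤ 2 * k, ‖f i‖ = 1 := fun i hi => SA.onCircle _ (fV i hi)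
  have gc : ∀ i ≤ 2 * l, ‖g i‖ = 1 := fun i hi => SB.onCircle _ (gV i hi)
  have f0 : f 0 = x := by
    obtain ⟨i, hi, hix⟩ := fsurj x hxV
    rcases Nat.eq_zero_or_pos i with h0 | h0
    · rw [← h0, hix]
    · have := fmono 0 i h0 hi
      rw [hix, crd_self] at this
      linarith [crd_nonneg x (f 0)]
  have fk : f k = y := by
    have := fE1 0 (by omega)
    rw [f0, zero_add] at this
    exact (SA.outdeg x hxV).unique this hxyA
  obtain ⟨j, hj, rfl⟩ := fsurj a₁ (SA.endmem _ ha).2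
  have hjk : j < k := by
    by_contra hc
    have := fle k j (by omega) hj
    rw [fk] at this
    linarith
  have fa0 : f (j + k + 1) = a₀ := (SA.indeg _ (fV j hj)).unique (fE2 j hjk) ha
  obtain ⟨q, hq, rfl⟩ := gsurj b₀ (SB.endmem _ hb).1
  have hql : q ≤ l := by
    by_contra hc
    have h1 := gE2 (q - l - 1) (by omega)
    have h2 : q - l - 1 + l + 1 = q := by omega
    rw [h2] at h1
    have h3 : g (q - l - 1) = b₁ := (SB.outdeg _ (gV q hq)).unique h1 hb
    have h4 := gle (q - l - 1) q (by omega) hq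
    rw [h3] at h4
    linarith
  have gb1' : g (q + l) = b₁ := (SB.outdeg _ (gV q hq)).unique (gE1 q hql) hb
  -- edges of `S_B` leaving the arc from `x` to `y` end after `y`
  have hout : ∀ p ≤ q, crd x y < crd x (g (p + l)) := by
    intro p hp
    by_contra hc
    push Not at hc
    have he := gE1 p (by omega)
    refine no_inner hD hxy (hsub SB hB he) ?_ (hBV (gV p (by omega)))
      (gmono p (p + l) (by omega) (by omega)) hc
    intro hc2
    rw [hc2] at he
    exact hdisj SA hA SB hB hAB _ hxyA he
  -- choose the first edge of `S_B` below the staircase of `S_A`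
  have hex : ∃ p, p ≤ q ∧ ∃ i ≤ j, crd x (f i) ≤ crd x (g p) ∧
      crd x (g (p + l)) < crd x (f (i + k + 1)) := by
    refine ⟨q, le_rfl, j, le_rfl, oa1, ?_⟩
    rw [gb1', fa0]
    exact oba
  obtain ⟨p, ⟨hpq, hexi⟩, hpmin⟩ : ∃ p, (p ≤ q ∧ ∃ i ≤ j, crd x (f i) ≤ crd x (g p) ∧
      crd x (g (p + l)) < crd x (f (i + k + 1))) ∧ ∀ p' < p, ¬ (p' ≤ q ∧ ∃ i ≤ j,
      crd x (f i) ≤ crd x (g p') ∧ crd x (g (p' + l)) < crd x (f (i + k + 1))) :=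
    ⟨Nat.find hex, Nat.find_spec hex, fun p' hp' => Nat.find_min hex hp'⟩
  obtain ⟨i, ⟨hij, hiu, hiv⟩, himin⟩ : ∃ i, (i ≤ j ∧ crd x (f i) ≤ crd x (g p) ∧
      crd x (g (p + l)) < crd x (f (i + k + 1))) ∧ ∀ i' < i, ¬ (i' ≤ j ∧
      crd x (f i') ≤ crd x (g p) ∧ crd x (g (p + l)) < crd x (f (i' + k + 1))) :=
    ⟨Nat.find hexi, Nat.find_spec hexi, fun i' hi' => Nat.find_min hexi hi'⟩
  have huv : crd x (g p) < crd x (g (p + l)) := gmono _ _ (by omega) (by omega)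
  have euv := gE1 p (by omega)
  have cu := gc p (by omega)
  have cv := gc (p + l) (by omega)
  have ci := fc i (by omega)
  have hge : crd x (f (i + k)) ≤ crd x (g (p + l)) := by
    rcases Nat.eq_zero_or_pos i with h0 | h0
    · rw [h0, zero_add, fk]
      exact (hout p hpq).le
    · by_contra hc
      push Not at hc
      apply himin (i - 1) (by omega)
      refine ⟨by omega, (fle (i - 1) i (by omega) (by omega)).trans hiu, ?_⟩
      have : i - 1 + k + 1 = i + k := by omega
      rw [this]
      exact hc
  -- the successor of `v = g (p + l)`
  obtain ⟨w, ew, hw⟩ : ∃ w, (g (p + l), w) ∈ SB.E ∧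
      posArc (g (p + l)) w < posArc (g (p + l)) (f i) := by
    rw [posArc_of_le hx cv ci (by linarith)]
    rcases Nat.eq_zero_or_pos p with h0 | h0
    · subst h0
      refine ⟨g (l + l), ?_, ?_⟩
      · rw [zero_add]
        exact gE1 l le_rfl
      · rw [posArc_of_lt hx cv (gc (l + l) (by omega)) (gmono _ _ (by omega) (by omega))]
        have := crd_lt hx (gc (l + l) (by omega))
        have := crd_nonneg x (f i)
        linarith
    · refine ⟨g (p - 1), ?_, ?_⟩
      · have := gE2 (p - 1) (by omega)
        have e : p - 1 + l + 1 = p + l := by omega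
        rw [e] at this
        exact this
      · rw [posArc_of_le hx cv (gc (p - 1) (by omega)) (gle _ _ (by omega) (by omega))]
        have : crd x (g (p - 1)) < crd x (f i) := by
          by_contra hc
          push Not at hc
          apply hpmin (p - 1) (by omega)
          refine ⟨by omega, i, hij, hc, ?_⟩
          have := gmono (p - 1 + l) (p + l) (by omega) (by omega)
          linarith
        linarith
  have ek1 := fE1 i (by omega)
  have ek2 := fE2 i (by omega)
  have hvne : f (i + k) ≠ g (p + l) := by
    intro hc
    rw [hc] at ek1
    rcases hiu.lt_or_eq with h1 | h1
    · refine not_inside h hB euv ew (Or.inr (hsub SA hA ek1)) hw ?_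
      rw [posArc_of_le hx cv ci (by linarith), posArc_of_le hx cv cu huv.le]
      linarith
    · have := crd_inj hx ci cu h1
      rw [this] at ek1
      exact hdisj SA hA SB hB hAB _ ek1 euv
  have hgt' : crd x (f (i + k)) < crd x (g (p + l)) :=
    lt_of_le_of_ne hge (fun hc => hvne (crd_inj hx (fc _ (by omega)) cv hc))
  have hiik := fmono i (i + k) (by omega) (by omega)
  have hs1 : posArc (f i) (f (i + k)) < posArc (f i) (g (p + l)) := by
    rw [posArc_of_lt hx ci (fc _ (by omega)) hiik, posArc_of_lt hx ci cv (by linarith)]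
    linarith
  have hs2 : posArc (f i) (g (p + l)) < posArc (f i) (f (i + k + 1)) := by
    rw [posArc_of_lt hx ci (fc (i + k + 1) (by omega)) (by linarith),
      posArc_of_lt hx ci cv (by linarith)]
    linarith
  have hune : crd x (f i) ≠ crd x (g p) := by
    intro hc
    have hc' := crd_inj hx ci cu hc
    rw [← hc'] at euv
    exact not_inside h hA ek2 ek1 (Or.inl (hsub SB hB euv)) hs1 hs2
  have hult : crd x (f i) < crd x (g p) := lt_of_le_of_ne hiu hune
  have hne : f i ≠ g (p + l) := by
    intro hc
    rw [hc] at hiu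
    linarith
  refine ⟨f i, g (p + l), fV i (by omega), gV _ (by omega), ?_, hne, ?_, ?_⟩
  · by_cases h1 : f i = x
    · exact Or.inl h1
    · rcases hij.lt_or_eq with h2 | h2
      · refine Or.inr (Or.inr ⟨h1, ?_⟩)
        have h3 := fmono i j h2 hj
        have h4 : f j ≠ x := by
          intro hc
          rw [hc, crd_self] at h3
          linarith [crd_nonneg x (f i)]
        rwa [crd, if_neg h1, crd, if_neg h4] at h3
      · exact Or.inr (Or.inl (by rw [h2]))
  · exact splitsVertex_of_between SA ek2 ek1 cv hne.symm hs1 hs2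
  · refine splitsVertex_of_between SB euv ew ci hne hw ?_
    rw [posArc_of_le hx cv ci (by linarith), posArc_of_le hx cv cu huv.le]
    linarith

end
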